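/- Let a > b > 0 and b < β < a, and let n = 2m+1 be an odd integer with m ≥ 1. Then the m×m Hankel determinant det(C_{i+j+2})_{0 ≤ i,j ≤ m−1} vanishes, where C_k are the Taylor coefficients at 0 of √((a−x)(b−x)(β−x))/(b−x), if and only if there exist real polynomials p and q with deg p = m and deg q = m−1 satisfying (s − 1/b) p(s)² − s(s − 1/a)(s − 1/β) q(s)² = −1 in ℝ[s]. (Both conditions characterize the n-periodicity, for odd n, of trajectories of the magic billiard in the ellipse with flipping over the long axis and hyperbola caustic: Corollaries 3.1 and 3.2(b).) -/

import Mathlib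

open Polynomial

lemma aux_reflect (a b β : ℝ) (k : ℕ) (p q : ℝ[X]) (hp : p.natDegree ≤ k + 1) (hq : q.natDegree ≤ k) :
    reflect (2 * k + 3) ((X - Polynomial.C (1 / b)) * p ^ 2 -
          X * (X - Polynomial.C (1 / a)) * (X - Polynomial.C (1 / β)) * q ^ 2) =
    (1 - C (1/b) * X) * (reflect (k+1) p)^2 - (1 - C (1/a) * X) * (1 - C (1/β) * X) * (reflect k q)^2 := by
  have h1 : ∀ c : ℝ, reflect 1 (X - C c : ℝ[X]) = 1 - C c * X := by
    intro c
    rw [reflect_sub, reflect_one_X, reflect_C, pow_one]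
  have hd : ∀ c : ℝ, (X - C c : ℝ[X]).natDegree ≤ 1 := fun c => (natDegree_X_sub_C c).le
  rw [reflect_sub, pow_two, pow_two, show 2 * k + 3 = 1 + ((k+1)+(k+1)) by ring,
    reflect_mul _ _ (hd _) (natDegree_mul_le_of_le hp hp), reflect_mul _ _ hp hp, h1,
    show 1 + ((k+1)+(k+1)) = (1 + 1 + 1) + (k+k) by ring,
    reflect_mul _ _ (natDegree_mul_le_of_le (natDegree_mul_le_of_le natDegree_X_le (hd _)) (hd _))
      (natDegree_mul_le_of_le hq hq),
    reflect_mul _ _ (natDegree_mul_le_of_le natDegree_X_le (hd _)) (hd _),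
    reflect_mul _ _ natDegree_X_le (hd _), reflect_mul _ _ hq hq, h1, h1, reflect_one_X]
  ring

lemma aux_coeff (G : PowerSeries ℝ) (k n : ℕ) (hn : k ≤ n) (Q : ℝ[X]) (hQ : Q.natDegree ≤ k) :
    PowerSeries.coeff n (G * (Q : PowerSeries ℝ)) =
      ∑ j : Fin (k+1), PowerSeries.coeff (n - k + j) G * Q.coeff (k - j) := by
  rw [mul_comm, PowerSeries.coeff_mul, Finset.Nat.sum_antidiagonal_eq_sum_range_succ_mk]
  rw [Fin.sum_univ_eq_sum_range (fun j => PowerSeries.coeff (n - k + j) G * Q.coeff (k - j)),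
    ← Finset.sum_range_reflect (fun j => PowerSeries.coeff (n - k + j) G * Q.coeff (k - j)) (k+1)]
  symm
  apply Finset.sum_subset_zero_on_sdiff
  · intro i; simp only [Finset.mem_range]; omega
  · intro i hi
    simp only [Finset.mem_sdiff, Finset.mem_range] at hi
    simp [Polynomial.coeff_eq_zero_of_natDegree_lt (show Q.natDegree < i by omega)]
  · intro i hi
    simp only [Finset.mem_range] at hi
    rw [show n - k + (k + 1 - 1 - i) = n - i by omega, show k - (k+1-1-i) = i by omega]
    simp [mul_comm]

lemma aux_hankel (G : PowerSeries ℝ) (k : ℕ) :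
    (Matrix.of fun i j : Fin (k+1) => PowerSeries.coeff ((i : ℕ) + (j : ℕ) + 2) G).det = 0 ↔
    ∃ Q : ℝ[X], Q ≠ 0 ∧ Q.natDegree ≤ k ∧
      ∀ n, k + 2 ≤ n → n ≤ 2 * k + 2 → PowerSeries.coeff n (G * (Q : PowerSeries ℝ)) = 0 := by
  rw [← Matrix.exists_mulVec_eq_zero_iff]
  constructor
  · rintro ⟨v, hv, h⟩
    obtain ⟨j0, hj0⟩ := Function.ne_iff.1 hv
    let Q : ℝ[X] := ∑ j : Fin (k+1), monomial (k - (j:ℕ)) (v j)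
    have hc : ∀ j : Fin (k+1), Q.coeff (k - j) = v j := by
      intro j
      simp only [Q, finsetSum_coeff, coeff_monomial]
      rw [Finset.sum_eq_single j]
      · simp
      · intro i _ hi
        rw [if_neg]
        intro h; apply hi; ext; have := i.2; have := j.2; omega
      · simp
    have hd : Q.natDegree ≤ k :=
      natDegree_sum_le_of_forall_le _ _ fun i _ => (natDegree_monomial_le _).trans (by omega)
    refine ⟨Q, ?_, hd, ?_⟩
    · intro h0
      apply hj0
      rw [← hc, h0]; simp
    · intro n h1 h2
      rw [aux_coeff G k n (by omega) Q hd]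
      have := congrFun h ⟨n - (k+2), by omega⟩
      simp only [Matrix.mulVec, dotProduct, Matrix.of_apply, Pi.zero_apply] at this
      rw [← this]
      refine Finset.sum_congr rfl fun j _ => ?_
      rw [hc, show n - k + (j:ℕ) = n - (k+2) + j + 2 by omega]
  · rintro ⟨Q, hQ, hd, h⟩
    refine ⟨fun j => Q.coeff (k - j), ?_, ?_⟩
    · intro h0
      apply hQ
      ext i
      by_cases hi : i ≤ k
      · have := congrFun h0 ⟨k - i, by omega⟩
        simp only [Pi.zero_apply] at this
        rw [show k - (k - i) = i by omega] at this
        simpa using this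
      · simp [Polynomial.coeff_eq_zero_of_natDegree_lt (show Q.natDegree < i by omega)]
    · ext i
      have := h (k + 2 + i) (by omega) (by have := i.2; omega)
      rw [aux_coeff G k _ (by omega) Q hd] at this
      simp only [Matrix.mulVec, dotProduct, Matrix.of_apply, Pi.zero_apply]
      rw [← this]
      refine Finset.sum_congr rfl fun j _ => ?_
      rw [show k + 2 + (i:ℕ) - k + (j:ℕ) = i + j + 2 by omega]

noncomputable def auxT (f : ℝ → ℝ) : PowerSeries ℝ :=
  PowerSeries.mk fun k => iteratedDeriv k f 0 / (Nat.factorial k : ℝ)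

lemma auxT_mul (f g : ℝ → ℝ) (hf : AnalyticAt ℝ f 0) (hg : AnalyticAt ℝ g 0) :
    auxT (f * g) = auxT f * auxT g := by
  ext n
  rw [PowerSeries.coeff_mul, Finset.Nat.sum_antidiagonal_eq_sum_range_succ_mk]
  simp only [auxT, PowerSeries.coeff_mk]
  rw [iteratedDeriv_mul hf.contDiffAt hg.contDiffAt, Finset.sum_div]
  refine Finset.sum_congr rfl fun i hi => ?_
  have hi' : i ≤ n := by simp at hi; omega
  rw [Nat.cast_choose ℝ hi']
  have := Nat.factorial_ne_zero n
  have := Nat.factorial_ne_zero i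
  have := Nat.factorial_ne_zero (n - i)
  field_simp

lemma auxT_congr (f g : ℝ → ℝ) (h : f =ᶠ[nhds 0] g) : auxT f = auxT g := by
  ext n
  simp only [auxT, PowerSeries.coeff_mk]
  rw [h.iteratedDeriv_eq]

lemma auxT_sub (c : ℝ) : auxT (fun x => c - x) = ((Polynomial.C c - X : ℝ[X]) : PowerSeries ℝ) := by
  ext n
  rw [Polynomial.coeff_coe]
  simp only [auxT, PowerSeries.coeff_mk]
  rcases n with _ | _ | n
  · simp
  · rw [iteratedDeriv_const_sub (by omega)]
    simp [coeff_C]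
  · rw [iteratedDeriv_const_sub (by omega)]
    rw [iteratedDeriv_neg, iteratedDeriv_succ', iteratedDeriv_succ']
    simp [coeff_C, coeff_X, iteratedDeriv_const]

lemma aux_series (a b β : ℝ) (hb : 0 < b) 
    (g : ℝ → ℝ) (hg : AnalyticAt ℝ g 0)
    (hgsq : ∀ᶠ x in nhds (0 : ℝ),
      (g x) ^ 2 * (b - x) ^ 2 = (a - x) * (b - x) * (β - x)) :
    ((Polynomial.C b - X : ℝ[X]) : PowerSeries ℝ) * (auxT g) ^ 2 = 
      (((Polynomial.C a - X) * (Polynomial.C β - X) : ℝ[X]) : PowerSeries ℝ) := by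
  have han : ∀ c : ℝ, AnalyticAt ℝ (fun x : ℝ => c - x) 0 := fun c => by fun_prop
  rw [Polynomial.coe_mul, ← auxT_sub, ← auxT_sub, ← auxT_sub, pow_two, ← auxT_mul _ _ hg hg,
    ← auxT_mul _ _ (han _) (hg.mul hg), ← auxT_mul _ _ (han _) (han _)]
  apply auxT_congr
  have : ∀ᶠ x in nhds (0:ℝ), x < b := eventually_lt_nhds hb
  filter_upwards [hgsq, this] with x hx hxb
  simp only [Pi.mul_apply]
  have : b - x ≠ 0 := by linarith
  apply mul_left_cancel₀ this
  linear_combination hx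

/-- normalised series -/
lemma aux_norm (a b β : ℝ) (ha : 0 < a) (hb : 0 < b) (hβ : 0 < β) (G : PowerSeries ℝ)
    (h : ((Polynomial.C b - X : ℝ[X]) : PowerSeries ℝ) * G ^ 2 = 
      (((Polynomial.C a - X) * (Polynomial.C β - X) : ℝ[X]) : PowerSeries ℝ)) :
    ((1 - Polynomial.C (1/b) * X : ℝ[X]) : PowerSeries ℝ) *
        ((Polynomial.C (√(b/(a*β))) : ℝ[X]) * G) ^ 2 = 
      (((1 - Polynomial.C (1/a) * X) * (1 - Polynomial.C (1/β) * X) : ℝ[X]) : PowerSeries ℝ) := by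
  have e : ∀ c : ℝ, 0 < c → (1 - Polynomial.C (1/c) * X : ℝ[X]) = C (1/c) * (C c - X) := by
    intro c hc
    rw [mul_sub, ← C_mul, one_div_mul_cancel hc.ne', C_1]
  have hr : (C (√(b/(a*β))) : ℝ[X])^2 = C (b/(a*β)) := by
    rw [← C_pow, Real.sq_sqrt (by positivity)]
  have h2 : (C (1/b) * C (b/(a*β)) : ℝ[X]) = C (1/a) * C (1/β) := by
    rw [← C_mul, ← C_mul]; congr 1; field_simp
  have hr' := congrArg (fun p : ℝ[X] => (p : PowerSeries ℝ)) hr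
  have h2' := congrArg (fun p : ℝ[X] => (p : PowerSeries ℝ)) h2
  simp only [Polynomial.coe_mul, Polynomial.coe_pow] at hr' h2'
  rw [e b hb, e a ha, e β hβ]
  simp only [Polynomial.coe_mul] at h ⊢
  rw [mul_pow, hr']
  linear_combination (((C (1/b) : ℝ[X]) : PowerSeries ℝ) * ((C (b/(a*β)) : ℝ[X]) : PowerSeries ℝ)) * h +
    (((C a - X : ℝ[X]) : PowerSeries ℝ) * ((C β - X : ℝ[X]) : PowerSeries ℝ)) * h2'

lemma aux_fwd (a b β : ℝ) (hab : b < a) (hb : 0 < b) (hβb : b < β) (k : ℕ) (H : PowerSeries ℝ)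
    (hH : ((1 - Polynomial.C (1/b) * X : ℝ[X]) : PowerSeries ℝ) * H ^ 2 = 
      (((1 - Polynomial.C (1/a) * X) * (1 - Polynomial.C (1/β) * X) : ℝ[X]) : PowerSeries ℝ))
    (Q : ℝ[X]) (hQ0 : Q ≠ 0) (hQ : Q.natDegree ≤ k) (hc : ∀ n, k + 2 ≤ n → n ≤ 2 * k + 2 → 
      PowerSeries.coeff n (H * (Q : PowerSeries ℝ)) = 0) :
    ∃ P Q : ℝ[X], P.natDegree ≤ k + 1 ∧ Q.natDegree ≤ k ∧ P.coeff 0 ≠ 0 ∧ Q.coeff 0 ≠ 0 ∧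
      (1 - C (1/b) * X) * P^2 - (1 - C (1/a) * X) * (1 - C (1/β) * X) * Q^2 = - X ^ (2 * k + 3) := by
  obtain ⟨P, hPdef⟩ : ∃ P, P = PowerSeries.trunc (k+2) (H * (Q : PowerSeries ℝ)) := ⟨_, rfl⟩
  have hP : P.natDegree ≤ k + 1 := by
    have := PowerSeries.natDegree_trunc_lt (H * (Q : PowerSeries ℝ)) (k+1)
    rw [hPdef]; exact Nat.lt_succ_iff.1 this
  have hPc : ∀ n, n ≤ k + 1 → P.coeff n = PowerSeries.coeff n (H * (Q : PowerSeries ℝ)) := by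
    intro n hn
    rw [hPdef, PowerSeries.coeff_trunc, if_pos (by omega)]
  have hdvd : (PowerSeries.X : PowerSeries ℝ) ^ (2 * k + 3) ∣ (P : PowerSeries ℝ) - H * Q := by
    rw [PowerSeries.X_pow_dvd_iff]
    intro n hn
    rw [map_sub, Polynomial.coeff_coe]
    by_cases h : n ≤ k + 1
    · rw [hPc n h, sub_self]
    · rw [hc n (by omega) (by omega), Polynomial.coeff_eq_zero_of_natDegree_lt (by omega), sub_self]
  have hd1 : ∀ c : ℝ, (1 - C c * X : ℝ[X]).natDegree ≤ 1 := by
    intro c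
    compute_degree
  have hd1' : ∀ c : ℝ, 0 < c → (1 - C (1/c) * X : ℝ[X]).natDegree = 1 := by
    intro c hc
    have : 1 / c ≠ 0 := by positivity
    compute_degree!
    simpa using hc.ne'
  obtain ⟨D, hD⟩ : ∃ D, D = (1 - C (1/b) * X) * P^2 - (1 - C (1/a) * X) * (1 - C (1/β) * X) * Q^2 := ⟨_, rfl⟩
  have hDdeg : D.natDegree ≤ 2 * k + 3 := by
    rw [hD]
    refine (natDegree_sub_le _ _).trans (max_le ?_ ?_)
    · have := natDegree_mul_le_of_le (hd1 (1/b)) (natDegree_pow_le_of_le 2 hP)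
      omega
    · have := natDegree_mul_le_of_le (natDegree_mul_le_of_le (hd1 (1/a)) (hd1 (1/β))) (natDegree_pow_le_of_le 2 hQ)
      omega
  have hDfac : (D : PowerSeries ℝ) = ((P : PowerSeries ℝ) - H * Q) *
      (((1 - C (1/b) * X : ℝ[X]) : PowerSeries ℝ) * ((P : PowerSeries ℝ) + H * Q)) := by
    rw [hD, Polynomial.coe_sub, Polynomial.coe_mul, Polynomial.coe_mul _ (Q^2), ← hH,
      Polynomial.coe_pow, Polynomial.coe_pow]
    ring
  have hDdvd : (PowerSeries.X : PowerSeries ℝ) ^ (2 * k + 3) ∣ (D : PowerSeries ℝ) := by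
    rw [hDfac]; exact hdvd.mul_right _
  have hDc : D = C (D.coeff (2 * k + 3)) * X ^ (2 * k + 3) := by
    ext n
    rw [coeff_C_mul_X_pow]
    split_ifs with h
    · rw [h]
    · rcases lt_or_gt_of_ne h with h | h
      · rw [PowerSeries.X_pow_dvd_iff] at hDdvd
        rw [← Polynomial.coeff_coe]; exact hDdvd n h
      · exact Polynomial.coeff_eq_zero_of_natDegree_lt (by omega)
  obtain ⟨c, hcdef⟩ : ∃ c, c = D.coeff (2*k+3) := ⟨_, rfl⟩
  rw [← hcdef] at hDc
  have ha : 0 < a := by linarith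
  have hβ : 0 < β := by linarith
  have hc0 : c ≠ 0 := by
    rintro rfl
    rw [C_0, zero_mul] at hDc
    rw [hDc] at hD
    have hE := (sub_eq_zero.1 hD.symm)
    have n1 : ∀ c : ℝ, 0 < c → (1 - C (1/c) * X : ℝ[X]) ≠ 0 := by
      intro c hc h
      have := hd1' c hc
      rw [h] at this; simp at this
    have hP0 : P ≠ 0 := by
      rintro rfl
      rw [zero_pow two_ne_zero, mul_zero] at hE
      exact mul_ne_zero (mul_ne_zero (n1 a ha) (n1 β hβ)) (pow_ne_zero 2 hQ0) hE.symm
    have := congrArg natDegree hE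
    rw [natDegree_mul (n1 b hb) (pow_ne_zero 2 hP0),
      natDegree_mul (mul_ne_zero (n1 a ha) (n1 β hβ)) (pow_ne_zero 2 hQ0),
      natDegree_mul (n1 a ha) (n1 β hβ), hd1' _ hb, hd1' _ ha, hd1' _ hβ, natDegree_pow, natDegree_pow] at this
    omega
  have hcneg : c < 0 := by
    refine lt_of_le_of_ne ?_ hc0
    have h := congrArg (eval b) (hD.symm.trans hDc)
    simp only [eval_sub, eval_mul, eval_pow, eval_one, eval_C, eval_X] at h
    rw [one_div_mul_cancel hb.ne', sub_self, zero_mul, zero_sub] at h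
    have h1 : 0 ≤ 1 - 1 / a * b := by
      rw [one_div_mul_eq_div, sub_nonneg, div_le_one ha]; exact hab.le
    have h2 : 0 ≤ 1 - 1 / β * b := by
      rw [one_div_mul_eq_div, sub_nonneg, div_le_one hβ]; exact hβb.le
    have h3 : 0 ≤ (1 - 1 / a * b) * (1 - 1 / β * b) * eval b Q ^ 2 := by positivity
    have h4 : 0 < b ^ (2 * k + 3) := by positivity
    by_contra hpos
    push Not at hpos
    have : 0 < c := hpos
    have : 0 < c * b ^ (2 * k + 3) := by positivity
    linarith
  have hQz : Q.coeff 0 ≠ 0 := by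
    intro h0
    have hX : (PowerSeries.X : PowerSeries ℝ) ∣ (P : PowerSeries ℝ) + H * Q := by
      rw [PowerSeries.X_dvd_iff, map_add, ← PowerSeries.coeff_zero_eq_constantCoeff_apply,
        ← PowerSeries.coeff_zero_eq_constantCoeff_apply, Polynomial.coeff_coe, hPc 0 (by omega)]
      have : PowerSeries.constantCoeff (Q : PowerSeries ℝ) = 0 := by
        rw [← PowerSeries.coeff_zero_eq_constantCoeff_apply, Polynomial.coeff_coe, h0]
      simp [this]
    have : (PowerSeries.X : PowerSeries ℝ) ^ (2 * k + 3 + 1) ∣ (D : PowerSeries ℝ) := by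
      rw [hDfac, pow_succ]
      exact mul_dvd_mul hdvd (hX.mul_left _)
    rw [PowerSeries.X_pow_dvd_iff] at this
    have := this (2 * k + 3) (by omega)
    rw [Polynomial.coeff_coe] at this
    exact hc0 (hcdef.trans this)
  have hPz : P.coeff 0 ≠ 0 := by
    intro h0
    have h := congrArg (fun p => coeff p 0) (hD.symm.trans hDc)
    simp only [coeff_zero_eq_eval_zero] at h h0 hQz
    simp [h0] at h
    exact hQz h
  have hcp : 0 < -c := by linarith
  have hs : (1 / √(-c)) ^ 2 * c = -1 := by
    rw [div_pow, Real.sq_sqrt hcp.le]; field_simp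
  have hs0 : 1 / √(-c) ≠ 0 := by positivity
  refine ⟨C (1 / √(-c)) * P, C (1 / √(-c)) * Q, (natDegree_C_mul_le _ _).trans hP,
    (natDegree_C_mul_le _ _).trans hQ, ?_, ?_, ?_⟩
  · rw [coeff_C_mul]; exact mul_ne_zero hs0 hPz
  · rw [coeff_C_mul]; exact mul_ne_zero hs0 hQz
  · have hs' := congrArg (C : ℝ → ℝ[X]) hs
    rw [C_mul, C_pow, C_neg, C_1] at hs'
    linear_combination (C (1 / √(-c)))^2 * (hD.symm.trans hDc) + X ^ (2 * k + 3) * hs'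

lemma aux_bwd (a b β : ℝ) (k : ℕ) (H : PowerSeries ℝ)
    (hH : ((1 - Polynomial.C (1/b) * X : ℝ[X]) : PowerSeries ℝ) * H ^ 2 = 
      (((1 - Polynomial.C (1/a) * X) * (1 - Polynomial.C (1/β) * X) : ℝ[X]) : PowerSeries ℝ))
    (P Q : ℝ[X]) (hP : P.natDegree ≤ k + 1) (hPz : P.coeff 0 ≠ 0)
    (hE : (1 - C (1/b) * X) * P^2 - (1 - C (1/a) * X) * (1 - C (1/β) * X) * Q^2 = - X ^ (2 * k + 3))
    (n : ℕ) (h1 : k + 2 ≤ n) (h2 : n ≤ 2 * k + 2) :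
      PowerSeries.coeff n (H * (Q : PowerSeries ℝ)) = 0 := by
  have hfac : (PowerSeries.X : PowerSeries ℝ) ^ (2 * k + 3) ∣ ((P : PowerSeries ℝ) - H * Q) *
      (((1 - C (1/b) * X : ℝ[X]) : PowerSeries ℝ) * ((P : PowerSeries ℝ) + H * Q)) := by
    have h := congrArg (fun p : ℝ[X] => (p : PowerSeries ℝ)) hE
    beta_reduce at h
    rw [Polynomial.coe_sub, Polynomial.coe_mul, Polynomial.coe_mul _ (Q^2), ← hH,
      Polynomial.coe_pow, Polynomial.coe_pow, Polynomial.coe_neg, Polynomial.coe_pow, Polynomial.coe_X] at h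
    refine ⟨-1, ?_⟩
    linear_combination h
  have hXw : ¬ (PowerSeries.X : PowerSeries ℝ) ∣ ((1 - C (1/b) * X : ℝ[X]) : PowerSeries ℝ) := by
    rw [PowerSeries.X_dvd_iff, ← PowerSeries.coeff_zero_eq_constantCoeff_apply, Polynomial.coeff_coe]
    simp
  have hp := PowerSeries.X_prime (R := ℝ)
  have key : ∀ ε : ℝ, PowerSeries.X ^ (2 * k + 3) ∣ (P : PowerSeries ℝ) - PowerSeries.C ε * (H * (Q : PowerSeries ℝ)) → ε ≠ 0 → 
      PowerSeries.coeff n (H * (Q : PowerSeries ℝ)) = 0 := by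
    intro ε hε hε0
    rw [PowerSeries.X_pow_dvd_iff] at hε
    have := hε n (by omega)
    rw [map_sub, Polynomial.coeff_coe, Polynomial.coeff_eq_zero_of_natDegree_lt (by omega),
      PowerSeries.coeff_C_mul, zero_sub, neg_eq_zero] at this
    exact (mul_eq_zero.1 this).resolve_left hε0
  by_cases hX : (PowerSeries.X : PowerSeries ℝ) ∣ (P : PowerSeries ℝ) - H * Q
  · have hX2 : ¬ (PowerSeries.X : PowerSeries ℝ) ∣ (P : PowerSeries ℝ) + H * Q := by
      intro h
      have := dvd_add hX h
      rw [PowerSeries.X_dvd_iff, ← PowerSeries.coeff_zero_eq_constantCoeff_apply] at this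
      simp only [map_add, map_sub, Polynomial.coeff_coe] at this
      apply hPz; linarith
    have := hp.pow_dvd_of_dvd_mul_right _ (fun h => (hp.dvd_or_dvd h).elim hXw hX2) hfac
    exact key 1 (by simpa using this) one_ne_zero
  · have h3 := hp.pow_dvd_of_dvd_mul_left _ hX hfac
    have h4 := hp.pow_dvd_of_dvd_mul_left _ hXw h3
    exact key (-1) (by simpa using h4) (by norm_num)

theorem stmt_10 (a b β : ℝ) (hab : b < a) (hb : 0 < b) (hβb : b < β) (hβa : β < a)
    (g : ℝ → ℝ) (hg : AnalyticAt ℝ g 0) (hg0 : g 0 = Real.sqrt (a * b * β) / b)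
    (hgsq : ∀ᶠ x in nhds (0 : ℝ),
      (g x) ^ 2 * (b - x) ^ 2 = (a - x) * (b - x) * (β - x))
    (C : ℕ → ℝ) (hC : ∀ k, C k = iteratedDeriv k g 0 / (Nat.factorial k : ℝ))
    (m n : ℕ) (hm : 1 ≤ m) (hn : n = 2 * m + 1) :
    (Matrix.of fun i j : Fin m => C ((i : ℕ) + (j : ℕ) + 2)).det = 0 ↔
      ∃ p q : Polynomial ℝ, p.degree = (m : WithBot ℕ) ∧ q.degree = ((m - 1 : ℕ) : WithBot ℕ) ∧
        (X - Polynomial.C (1 / b)) * p ^ 2 -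
          X * (X - Polynomial.C (1 / a)) * (X - Polynomial.C (1 / β)) * q ^ 2 = -1 := by
  obtain ⟨k, rfl⟩ : ∃ k, m = k + 1 := ⟨m - 1, by omega⟩
  have ha : 0 < a := by linarith
  have hβ : 0 < β := by linarith
  have hCT : ∀ j, C j = PowerSeries.coeff j (auxT g) := by
    intro j; rw [hC]; simp [auxT]
  simp only [hCT]
  rw [aux_hankel]
  have hH := aux_norm a b β ha hb hβ _ (aux_series a b β hb g hg hgsq)
  have hr : √(b/(a*β)) ≠ 0 := by positivity
  have hco : ∀ (Q : ℝ[X]) j, PowerSeries.coeff j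
      (((Polynomial.C (√(b/(a*β))) : ℝ[X]) : PowerSeries ℝ) * auxT g * (Q : PowerSeries ℝ)) =
      √(b/(a*β)) * PowerSeries.coeff j (auxT g * (Q : PowerSeries ℝ)) := by
    intro Q j
    rw [mul_assoc, Polynomial.coe_C, PowerSeries.coeff_C_mul]
  constructor
  · rintro ⟨Q, hQ0, hQ, hc⟩
    obtain ⟨P, Q, hP, hQ, hPz, hQz, hE⟩ := aux_fwd a b β hab hb hβb k _ hH Q hQ0 hQ
      (fun n h1 h2 => by rw [hco, hc n h1 h2, mul_zero])
    refine ⟨reflect (k+1) P, reflect k Q, ?_, ?_, ?_⟩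
    · apply degree_eq_of_le_of_coeff_ne_zero
      · exact degree_le_of_natDegree_le (natDegree_reflect_le.trans (by simpa using hP))
      · rw [coeff_reflect, revAt_le le_rfl, Nat.sub_self]; exact hPz
    · rw [Nat.add_sub_cancel]
      apply degree_eq_of_le_of_coeff_ne_zero
      · exact degree_le_of_natDegree_le (natDegree_reflect_le.trans (by simpa using hQ))
      · rw [coeff_reflect, revAt_le le_rfl, Nat.sub_self]; exact hQz
    · have := aux_reflect a b β k (reflect (k+1) P) (reflect k Q)
        (natDegree_reflect_le.trans (by simpa using hP)) (natDegree_reflect_le.trans (by simpa using hQ))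
      rw [reflect_reflect, reflect_reflect, hE] at this
      have := congrArg (reflect (2*k+3)) this
      rw [reflect_reflect] at this
      rw [this, reflect_neg, reflect_monomial, revAt_le le_rfl, Nat.sub_self, pow_zero]
  · rintro ⟨p, q, hp, hq, hE⟩
    rw [Nat.add_sub_cancel] at hq
    have hp' := natDegree_eq_of_degree_eq_some hp
    have hq' := natDegree_eq_of_degree_eq_some hq
    have h := aux_reflect a b β k p q hp'.le hq'.le
    rw [hE, reflect_neg, reflect_one] at h
    have hq0 : q ≠ 0 := by rintro rfl; simp at hq
    have hp0 : p ≠ 0 := by rintro rfl; simp at hp'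
    refine ⟨reflect k q, by rwa [Ne, reflect_eq_zero_iff], natDegree_reflect_le.trans (by simp [hq']), ?_⟩
    intro n h1 h2
    have := aux_bwd a b β k _ hH (reflect (k+1) p) (reflect k q)
      (natDegree_reflect_le.trans (by simp [hp'])) ?_ h.symm n h1 h2
    · rw [hco] at this
      exact (mul_eq_zero.1 this).resolve_left hr
    · rw [coeff_reflect, revAt_le (Nat.zero_le _), Nat.sub_zero, ← hp']
      exact leadingCoeff_ne_zero.2 hp0
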